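/- Let τ ∈ Hom(C,A) be a twisting cochain, i.e. a degree-1 element satisfying d(τ) + τ * τ = 0, ε_C-compatibility ε_A ∘ τ = 0 and τ ∘ η_C = 0. If M is a dg A-bimodule, then the twisted tensor product M ⊗_τ C, with differential d_{M⊗C} + ad(τ) (where ad(τ) is the graded commutator of the bimodule action of τ), is a dg bimodule over the twisted convolution algebra Hom^τ(C,A). -/

import Mathlib

open scoped TensorProduct

/-!
STATEMENT 7: Let `τ ∈ Hom(C,A)` be a twisting cochain (a degree-1 element with
`d(τ) + τ * τ = 0`, `ε_A ∘ τ = 0`, `τ ∘ η_C = 0`).  If `M` is a dg `A`-bimodule then the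
twisted tensor product `M ⊗_τ C`, with differential `d_{M⊗C} + ad(τ)` (graded commutator
of the bimodule action of `τ`), is a dg bimodule over the twisted convolution algebra
`Hom^τ(C,A)` (whose differential is `d_τ(f) = d f + τ * f - (-1)^{deg f} f * τ`).
-/

/-- The sign operator scaling the degree-`i` component by `(-1)^{q·i}`. -/
noncomputable def sgn {k C : Type} [CommRing k] [AddCommGroup C] [Module k C]
    (𝒞 : ℤ → Submodule k C) [DirectSum.Decomposition 𝒞] (q : ℤ) : C →ₗ[k] C :=
  (DirectSum.toModule k ℤ C fun i => (Int.negOnePow (q * i)) • (𝒞 i).subtype).comp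
    (DirectSum.decomposeLinearEquiv 𝒞).toLinearMap

/-- The graded flip `x ⊗ y ↦ (-1)^{deg x · deg y} y ⊗ x`. -/
noncomputable def koszulFlip {k X Y : Type} [CommRing k]
    [AddCommGroup X] [Module k X] [AddCommGroup Y] [Module k Y]
    (𝒳 : ℤ → Submodule k X) [DirectSum.Decomposition 𝒳]
    (𝒴 : ℤ → Submodule k Y) [DirectSum.Decomposition 𝒴] :
    X ⊗[k] Y →ₗ[k] Y ⊗[k] X :=
  TensorProduct.lift <|
    (DirectSum.toModule k ℤ (Y →ₗ[k] Y ⊗[k] X) fun i =>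
      (((TensorProduct.mk k Y X).flip.compl₂ (sgn 𝒴 i)).comp (𝒳 i).subtype)).comp
      (DirectSum.decomposeLinearEquiv 𝒳).toLinearMap

/-- Convolution product on `Hom(C, A)` (`q = deg ψ`). -/
noncomputable def conv {k C A : Type} [CommRing k] [AddCommGroup C] [Module k C]
    [Ring A] [Algebra k A]
    (𝒞 : ℤ → Submodule k C) [DirectSum.Decomposition 𝒞]
    (Δ : C →ₗ[k] C ⊗[k] C) (φ ψ : C →ₗ[k] A) (q : ℤ) : C →ₗ[k] A :=
  (LinearMap.mul' k A).comp ((TensorProduct.map (φ.comp (sgn 𝒞 q)) ψ).comp Δ)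

/-- Differential of `Hom(C,A)` (`p = deg φ`). -/
noncomputable def dconv {k C A : Type} [CommRing k] [AddCommGroup C] [Module k C]
    [Ring A] [Algebra k A]
    (dC : C →ₗ[k] C) (dA : A →ₗ[k] A) (φ : C →ₗ[k] A) (p : ℤ) : C →ₗ[k] A :=
  dA.comp φ - (Int.negOnePow p) • (φ.comp dC)

/-- `φ` is homogeneous of degree `p`. -/
def homDeg {k C A : Type} [CommRing k] [AddCommGroup C] [Module k C]
    [AddCommGroup A] [Module k A]
    (𝒞 : ℤ → Submodule k C) (𝒜 : ℤ → Submodule k A) (φ : C →ₗ[k] A) (p : ℤ) : Prop :=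
  ∀ i : ℤ, ∀ x ∈ 𝒞 i, φ x ∈ 𝒜 (i + p)

/-- The two-sided action `m ⊗ c ↦ (-1)^ε φ(c₍₃₎)·m·ψ(c₍₁₎) ⊗ c₍₂₎` of a pair of
homogeneous elements `φ, ψ` of `Hom(C, A)` (with `q = deg ψ`) on `M ⊗ C`; the Koszul
signs `ε = deg ψ · deg c + deg c₍₃₎ · (deg m + deg c₍₁₎ + deg c₍₂₎ + deg ψ)` are
implemented by the operators `sgn` and `koszulFlip`. -/
noncomputable def hact {k C A M : Type} [CommRing k]
    [AddCommGroup C] [Module k C] [Ring A] [Algebra k A]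
    [AddCommGroup M] [Module k M]
    (𝒞 : ℤ → Submodule k C) [DirectSum.Decomposition 𝒞]
    (ℳ : ℤ → Submodule k M) [DirectSum.Decomposition ℳ]
    (Δ : C →ₗ[k] C ⊗[k] C)
    (l : A →ₗ[k] M →ₗ[k] M) (r : M →ₗ[k] A →ₗ[k] M)
    (φ ψ : C →ₗ[k] A) (q : ℤ) : M ⊗[k] C →ₗ[k] M ⊗[k] C :=
  (TensorProduct.map (TensorProduct.lift (l.comp φ)) LinearMap.id).comp <|
  (TensorProduct.map (koszulFlip ℳ 𝒞) LinearMap.id).comp <|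
  (TensorProduct.assoc k M C C).symm.toLinearMap.comp <|
  (TensorProduct.map LinearMap.id (koszulFlip 𝒞 𝒞)).comp <|
  (TensorProduct.map (TensorProduct.lift (r.compl₂ ψ)) LinearMap.id).comp <|
  (TensorProduct.assoc k M C (C ⊗[k] C)).symm.toLinearMap.comp <|
  (TensorProduct.map LinearMap.id ((TensorProduct.map LinearMap.id Δ).comp Δ)).comp
  (TensorProduct.map LinearMap.id (sgn 𝒞 q))

/-- The degree-`n` component of the tensor-product grading on `M ⊗ C`. -/
noncomputable def tgrade {k M C : Type} [CommRing k]
    [AddCommGroup M] [Module k M] [AddCommGroup C] [Module k C]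
    (ℳ : ℤ → Submodule k M) (𝒞 : ℤ → Submodule k C) (n : ℤ) :
    Submodule k (M ⊗[k] C) :=
  ⨆ u : ℤ, LinearMap.range (TensorProduct.map (ℳ u).subtype (𝒞 (n - u)).subtype)

section helpers

/-- sign as a scalar -/
def sg (k : Type) [CommRing k] (n : ℤ) : k := ((n.negOnePow : ℤ) : k)

variable {k C A M : Type} [CommRing k]
    [AddCommGroup C] [Module k C] [Ring A] [Algebra k A]
    [AddCommGroup M] [Module k M]

theorem unit_smul_sg (n : ℤ) (x : M) : n.negOnePow • x = sg k n • x := by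
  rw [Units.smul_def, sg, Int.cast_smul_eq_zsmul]

theorem sg_add (a b : ℤ) : sg k (a + b) = sg k a * sg k b := by
  simp [sg, Int.negOnePow_add]

theorem sg_congr {a b : ℤ} (h : Even (a - b)) : sg k a = sg k b := by
  rw [sg, sg, (Int.negOnePow_eq_iff a b).2 h]

theorem sg_neg' (a : ℤ) : - sg k a = sg k (a + 1) := by
  simp [sg, Int.negOnePow_add]

theorem sg_zero : sg k 0 = 1 := by simp [sg]
theorem sg_one : sg k 1 = -1 := by simp [sg]

theorem dec_lof (𝒞 : ℤ → Submodule k C) [DirectSum.Decomposition 𝒞] {i : ℤ} {x : C}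
    (hx : x ∈ 𝒞 i) : DirectSum.decomposeLinearEquiv 𝒞 x
      = DirectSum.lof k ℤ (fun i => 𝒞 i) i ⟨x, hx⟩ :=
  DirectSum.decompose_of_mem 𝒞 hx

theorem sgn_apply (𝒞 : ℤ → Submodule k C) [DirectSum.Decomposition 𝒞] (q : ℤ) {i : ℤ} {x : C}
    (hx : x ∈ 𝒞 i) : sgn 𝒞 q x = sg k (q * i) • x := by
  have h := dec_lof 𝒞 hx
  rw [sgn, LinearMap.comp_apply, LinearEquiv.coe_coe, h, DirectSum.toModule_lof]
  simp [unit_smul_sg (k := k)]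

theorem koszulFlip_apply (𝒞 : ℤ → Submodule k C) [DirectSum.Decomposition 𝒞]
    (ℳ : ℤ → Submodule k M) [DirectSum.Decomposition ℳ] {i j : ℤ} {x : C} {y : M}
    (hx : x ∈ 𝒞 i) (hy : y ∈ ℳ j) :
    koszulFlip 𝒞 ℳ (x ⊗ₜ y) = sg k (i * j) • (y ⊗ₜ[k] x) := by
  rw [koszulFlip, TensorProduct.lift.tmul, LinearMap.comp_apply, LinearEquiv.coe_coe,
    dec_lof 𝒞 hx, DirectSum.toModule_lof]
  simp [sgn_apply ℳ i hy, TensorProduct.smul_tmul']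

theorem hom_ext1 {X : Type} [AddCommGroup X] [Module k X]
    (𝒞 : ℤ → Submodule k C) [DirectSum.Decomposition 𝒞] {f g : C →ₗ[k] X}
    (h : ∀ i, ∀ c ∈ 𝒞 i, f c = g c) : f = g := by
  ext c
  induction c using DirectSum.Decomposition.inductionOn 𝒞 with
  | zero => simp
  | homogeneous c => exact h _ _ c.2
  | add a b ha hb => simp [ha, hb]

theorem hom_ext2 {X : Type} [AddCommGroup X] [Module k X]
    (ℳ : ℤ → Submodule k M) [DirectSum.Decomposition ℳ]
    (𝒞 : ℤ → Submodule k C) [DirectSum.Decomposition 𝒞] {f g : M ⊗[k] C →ₗ[k] X}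
    (h : ∀ u i, ∀ m ∈ ℳ u, ∀ c ∈ 𝒞 i, f (m ⊗ₜ c) = g (m ⊗ₜ c)) : f = g := by
  apply TensorProduct.ext
  apply hom_ext1 ℳ
  intro u m hm
  apply hom_ext1 𝒞
  intro i c hc
  exact h u i m hm c hc

theorem delta_ind {X : Type} [AddCommGroup X] [Module k X] (𝒞 : ℤ → Submodule k C)
    {Δ : C →ₗ[k] C ⊗[k] C}
    (hΔgr : ∀ n : ℤ, ∀ c ∈ 𝒞 n, Δ c ∈
      ⨆ p : ℤ, LinearMap.range (TensorProduct.map (𝒞 p).subtype (𝒞 (n - p)).subtype))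
    {n : ℤ} {c : C} (hc : c ∈ 𝒞 n) (F G : C ⊗[k] C →ₗ[k] X)
    (h : ∀ i j, i + j = n → ∀ a ∈ 𝒞 i, ∀ b ∈ 𝒞 j, F (a ⊗ₜ b) = G (a ⊗ₜ b)) :
    F (Δ c) = G (Δ c) := by
  have : (⨆ p : ℤ, LinearMap.range (TensorProduct.map (𝒞 p).subtype (𝒞 (n - p)).subtype))
      ≤ LinearMap.eqLocus F G := by
    apply iSup_le
    rintro p _ ⟨x, rfl⟩
    rw [LinearMap.mem_eqLocus]
    induction x with
    | zero => simp
    | add x y hx hy => simp only [map_add, hx, hy]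
    | tmul a b => exact h p (n - p) (by ring) _ a.2 _ b.2
  exact this (hΔgr n c hc)

/-- left action -/
noncomputable def Gop (𝒞 : ℤ → Submodule k C) [DirectSum.Decomposition 𝒞]
    (ℳ : ℤ → Submodule k M) [DirectSum.Decomposition ℳ]
    (l : A →ₗ[k] M →ₗ[k] M) (φ : C →ₗ[k] A) : M ⊗[k] (C ⊗[k] C) →ₗ[k] M ⊗[k] C :=
  (TensorProduct.map (TensorProduct.lift (l.comp φ)) LinearMap.id).comp <|
  (TensorProduct.map (koszulFlip ℳ 𝒞) LinearMap.id).comp <|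
  (TensorProduct.assoc k M C C).symm.toLinearMap.comp <|
  (TensorProduct.map LinearMap.id (koszulFlip 𝒞 𝒞))

noncomputable def Lop (𝒞 : ℤ → Submodule k C) [DirectSum.Decomposition 𝒞]
    (ℳ : ℤ → Submodule k M) [DirectSum.Decomposition ℳ] (Δ : C →ₗ[k] C ⊗[k] C)
    (l : A →ₗ[k] M →ₗ[k] M) (φ : C →ₗ[k] A) : Module.End k (M ⊗[k] C) :=
  (Gop 𝒞 ℳ l φ).comp (TensorProduct.map LinearMap.id Δ)

noncomputable def Hop (r : M →ₗ[k] A →ₗ[k] M) (ψ : C →ₗ[k] A) :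
    M ⊗[k] (C ⊗[k] C) →ₗ[k] M ⊗[k] C :=
  (TensorProduct.map (TensorProduct.lift (r.compl₂ ψ)) LinearMap.id).comp 
  (TensorProduct.assoc k M C C).symm.toLinearMap

noncomputable def Rop (𝒞 : ℤ → Submodule k C) [DirectSum.Decomposition 𝒞]
    (Δ : C →ₗ[k] C ⊗[k] C)
    (r : M →ₗ[k] A →ₗ[k] M) (ψ : C →ₗ[k] A) (q : ℤ) : Module.End k (M ⊗[k] C) :=
  (Hop r ψ).comp ((TensorProduct.map LinearMap.id Δ).comp 
    (TensorProduct.map LinearMap.id (sgn 𝒞 q)))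

theorem Gop_apply (𝒞 : ℤ → Submodule k C) [DirectSum.Decomposition 𝒞]
    (ℳ : ℤ → Submodule k M) [DirectSum.Decomposition ℳ]
    (l : A →ₗ[k] M →ₗ[k] M) (φ : C →ₗ[k] A) {u i j : ℤ} {m : M} {a b : C}
    (hm : m ∈ ℳ u) (ha : a ∈ 𝒞 i) (hb : b ∈ 𝒞 j) :
    Gop 𝒞 ℳ l φ (m ⊗ₜ (a ⊗ₜ b)) = sg k (j * (u + i)) • (l (φ b) m ⊗ₜ[k] a) := by
  simp only [Gop, LinearMap.comp_apply, TensorProduct.map_tmul, LinearMap.id_apply,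
    koszulFlip_apply 𝒞 𝒞 ha hb, TensorProduct.tmul_smul, map_smul, LinearEquiv.coe_coe,
    TensorProduct.assoc_symm_tmul, koszulFlip_apply ℳ 𝒞 hm hb, ← TensorProduct.smul_tmul',
    smul_smul, ← sg_add, TensorProduct.lift.tmul]
  congr 2; ring

theorem Hop_apply (r : M →ₗ[k] A →ₗ[k] M) (ψ : C →ₗ[k] A) (m : M) (a b : C) :
    Hop r ψ (m ⊗ₜ (a ⊗ₜ b)) = r m (ψ a) ⊗ₜ[k] b := by
  simp [Hop]

theorem Lop_apply (𝒞 : ℤ → Submodule k C) [DirectSum.Decomposition 𝒞]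
    (ℳ : ℤ → Submodule k M) [DirectSum.Decomposition ℳ] (Δ : C →ₗ[k] C ⊗[k] C)
    (l : A →ₗ[k] M →ₗ[k] M) (φ : C →ₗ[k] A) (m : M) (c : C) :
    Lop 𝒞 ℳ Δ l φ (m ⊗ₜ c) = Gop 𝒞 ℳ l φ (m ⊗ₜ Δ c) := rfl

theorem Rop_apply (𝒞 : ℤ → Submodule k C) [DirectSum.Decomposition 𝒞]
    (Δ : C →ₗ[k] C ⊗[k] C)
    (r : M →ₗ[k] A →ₗ[k] M) (ψ : C →ₗ[k] A) (q : ℤ) {m : M} {c : C} {i : ℤ} (hc : c ∈ 𝒞 i) :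
    Rop 𝒞 Δ r ψ q (m ⊗ₜ c) = sg k (q * i) • Hop r ψ (m ⊗ₜ Δ c) := by
  simp [Rop, sgn_apply 𝒞 q hc]

theorem hact_eq (𝒞 : ℤ → Submodule k C) [DirectSum.Decomposition 𝒞]
    (ℳ : ℤ → Submodule k M) [DirectSum.Decomposition ℳ] (Δ : C →ₗ[k] C ⊗[k] C)
    (l : A →ₗ[k] M →ₗ[k] M) (r : M →ₗ[k] A →ₗ[k] M)
    (φ ψ : C →ₗ[k] A) (q : ℤ) :
    hact 𝒞 ℳ Δ l r φ ψ q = Lop 𝒞 ℳ Δ l φ * Rop 𝒞 Δ r ψ q := by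
  apply TensorProduct.ext'
  intro m c
  simp only [hact, Lop, Rop, Gop, Hop, Module.End.mul_apply, LinearMap.comp_apply,
    TensorProduct.map_tmul, LinearMap.id_apply, LinearEquiv.coe_coe]
  generalize Δ (sgn 𝒞 q c) = t
  congr 4
  induction t with
  | zero => simp
  | add x y hx hy => simp only [map_add, TensorProduct.tmul_add, hx, hy]
  | tmul a b =>
    simp

theorem conv_apply (𝒞 : ℤ → Submodule k C) [DirectSum.Decomposition 𝒞]
    (Δ : C →ₗ[k] C ⊗[k] C) (φ ψ : C →ₗ[k] A) (q : ℤ) (c : C) :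
    conv 𝒞 Δ φ ψ q c = (LinearMap.mul' k A ∘ₗ (TensorProduct.map (φ.comp (sgn 𝒞 q)) ψ)) (Δ c) := rfl

theorem cv_apply (𝒞 : ℤ → Submodule k C) [DirectSum.Decomposition 𝒞]
    (φ ψ : C →ₗ[k] A) (q : ℤ) {i : ℤ} {a b : C} (ha : a ∈ 𝒞 i) :
    (LinearMap.mul' k A ∘ₗ (TensorProduct.map (φ.comp (sgn 𝒞 q)) ψ)) (a ⊗ₜ b)
      = sg k (q * i) • (φ a * ψ b) := by
  simp [sgn_apply 𝒞 q ha]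

theorem sg_smul_congr {X : Type} [AddCommGroup X] [Module k X] {a b : ℤ} (x : X)
    (h : Even (a - b)) : sg k a • x = sg k b • x := by
  rw [sg_congr h]

theorem conv_assoc (𝒞 : ℤ → Submodule k C) [DirectSum.Decomposition 𝒞]
    {Δ : C →ₗ[k] C ⊗[k] C}
    (hcoassoc : (TensorProduct.assoc k C C C).toLinearMap.comp
        ((TensorProduct.map Δ LinearMap.id).comp Δ)
      = (TensorProduct.map LinearMap.id Δ).comp Δ)
    (hΔgr : ∀ n : ℤ, ∀ c ∈ 𝒞 n, Δ c ∈
      ⨆ p : ℤ, LinearMap.range (TensorProduct.map (𝒞 p).subtype (𝒞 (n - p)).subtype))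
    (φ ψ χ : C →ₗ[k] A) (q s : ℤ) :
    conv 𝒞 Δ (conv 𝒞 Δ φ ψ q) χ s = conv 𝒞 Δ φ (conv 𝒞 Δ ψ χ s) (q + s) := by
  apply hom_ext1 𝒞
  intro n c hc
  have hco := LinearMap.congr_fun hcoassoc c
  simp only [LinearMap.comp_apply, LinearEquiv.coe_coe] at hco
  let K : C ⊗[k] (C ⊗[k] C) →ₗ[k] A := LinearMap.mul' k A ∘ₗ
    (TensorProduct.map (φ.comp (sgn 𝒞 (q + s)))
      (LinearMap.mul' k A ∘ₗ (TensorProduct.map (ψ.comp (sgn 𝒞 s)) χ)))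
  have h1 : conv 𝒞 Δ φ (conv 𝒞 Δ ψ χ s) (q + s) c
      = K (TensorProduct.map LinearMap.id Δ (Δ c)) := by
    rw [conv_apply]
    refine delta_ind 𝒞 hΔgr hc _ (K ∘ₗ TensorProduct.map LinearMap.id Δ) ?_
    intro i j hij a ha b hb
    simp [K, conv_apply]
  have h2 : conv 𝒞 Δ (conv 𝒞 Δ φ ψ q) χ s c
      = K (TensorProduct.assoc k C C C (TensorProduct.map Δ LinearMap.id (Δ c))) := by
    rw [conv_apply]
    refine delta_ind 𝒞 hΔgr hc _ (K ∘ₗ (TensorProduct.assoc k C C C).toLinearMap ∘ₗ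
      TensorProduct.map Δ LinearMap.id) ?_
    intro i j hij a ha b hb
    rw [cv_apply 𝒞 _ _ _ ha, conv_apply]
    refine delta_ind 𝒞 hΔgr ha (sg k (s * i) • (LinearMap.mulRight k (χ b) ∘ₗ
        (LinearMap.mul' k A ∘ₗ TensorProduct.map (φ ∘ₗ sgn 𝒞 q) ψ)))
      (K ∘ₗ (TensorProduct.assoc k C C C).toLinearMap ∘ₗ (TensorProduct.mk k _ _).flip b) ?_
    intro i₁ i₂ hi a₁ ha₁ a₂ ha₂
    subst hi
    simp [K, sgn_apply 𝒞 _ ha₁, sgn_apply 𝒞 _ ha₂, smul_smul, ← sg_add, mul_assoc]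
    apply sg_smul_congr
    simp only [Int.even_sub, Int.even_add, Int.even_mul]; grind
  rw [h1, h2, hco]

theorem conv_leib (𝒞 : ℤ → Submodule k C) [DirectSum.Decomposition 𝒞]
    (𝒜 : ℤ → Submodule k A)
    {Δ : C →ₗ[k] C ⊗[k] C} {dC : C →ₗ[k] C} {dA : A →ₗ[k] A}
    (hΔgr : ∀ n : ℤ, ∀ c ∈ 𝒞 n, Δ c ∈
      ⨆ p : ℤ, LinearMap.range (TensorProduct.map (𝒞 p).subtype (𝒞 (n - p)).subtype))
    (hdCdeg : ∀ i : ℤ, ∀ c ∈ 𝒞 i, dC c ∈ 𝒞 (i + 1))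
    (hcoder : Δ.comp dC
      = (TensorProduct.map dC LinearMap.id + TensorProduct.map (sgn 𝒞 1) dC).comp Δ)
    (hdAleib : ∀ i : ℤ, ∀ x ∈ 𝒜 i, ∀ y : A,
      dA (x * y) = dA x * y + (Int.negOnePow i) • (x * dA y))
    (p q : ℤ) (φ ψ : C →ₗ[k] A) (hφ : homDeg 𝒞 𝒜 φ p) :
    dconv dC dA (conv 𝒞 Δ φ ψ q) (p + q)
      = conv 𝒞 Δ (dconv dC dA φ p) ψ q
        + sg k p • conv 𝒞 Δ φ (dconv dC dA ψ q) (q + 1) := by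
  apply hom_ext1 𝒞
  intro n c hc
  have hco := LinearMap.congr_fun hcoder c
  simp only [LinearMap.comp_apply] at hco
  conv_lhs => simp only [dconv, unit_smul_sg (k := k), LinearMap.sub_apply, LinearMap.smul_apply,
    LinearMap.comp_apply, conv_apply, hco]
  simp only [LinearMap.add_apply, LinearMap.smul_apply, conv_apply]
  refine delta_ind 𝒞 hΔgr hc
    (dA ∘ₗ (LinearMap.mul' k A ∘ₗ TensorProduct.map (φ ∘ₗ sgn 𝒞 q) ψ) - sg k (p + q) •
      ((LinearMap.mul' k A ∘ₗ TensorProduct.map (φ ∘ₗ sgn 𝒞 q) ψ) ∘ₗ 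
       (TensorProduct.map dC LinearMap.id + TensorProduct.map (sgn 𝒞 1) dC)))
    ((LinearMap.mul' k A ∘ₗ TensorProduct.map (dconv dC dA φ p ∘ₗ sgn 𝒞 q) ψ) +
      sg k p • (LinearMap.mul' k A ∘ₗ TensorProduct.map (φ ∘ₗ sgn 𝒞 (q+1)) (dconv dC dA ψ q)))
    ?_
  intro i j hij a ha b hb
  simp [sgn_apply 𝒞 _ ha, sgn_apply 𝒞 _ (hdCdeg _ _ ha), dconv, hdAleib _ _ (hφ _ _ ha),
    unit_smul_sg (k := k), smul_smul, smul_add, smul_sub, mul_sub, sub_mul, ← sg_add]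
  match_scalars <;> simp only [mul_one, mul_neg, sg_neg', ← sg_add] <;> apply sg_congr <;>
    simp only [Int.even_sub, Int.even_add, Int.even_mul] <;> grind

theorem Lop_mul (𝒞 : ℤ → Submodule k C) [DirectSum.Decomposition 𝒞]
    (𝒜 : ℤ → Submodule k A)
    (ℳ : ℤ → Submodule k M) [DirectSum.Decomposition ℳ]
    {Δ : C →ₗ[k] C ⊗[k] C}
    (hcoassoc : (TensorProduct.assoc k C C C).toLinearMap.comp
        ((TensorProduct.map Δ LinearMap.id).comp Δ)
      = (TensorProduct.map LinearMap.id Δ).comp Δ)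
    (hΔgr : ∀ n : ℤ, ∀ c ∈ 𝒞 n, Δ c ∈
      ⨆ p : ℤ, LinearMap.range (TensorProduct.map (𝒞 p).subtype (𝒞 (n - p)).subtype))
    {l : A →ₗ[k] M →ₗ[k] M} 
    (hlmul : ∀ (x y : A) (m : M), l (x * y) m = l x (l y m))
    (hldeg : ∀ (i j : ℤ) (x : A) (m : M), x ∈ 𝒜 i → m ∈ ℳ j → l x m ∈ ℳ (i + j))
    (φ ψ : C →ₗ[k] A) (q : ℤ) (hψ : homDeg 𝒞 𝒜 ψ q) :
    Lop 𝒞 ℳ Δ l (conv 𝒞 Δ φ ψ q) = Lop 𝒞 ℳ Δ l φ * Lop 𝒞 ℳ Δ l ψ := by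
  apply hom_ext2 ℳ 𝒞
  intro u n m hm c hc
  have hco := LinearMap.congr_fun hcoassoc c
  simp only [LinearMap.comp_apply, LinearEquiv.coe_coe] at hco
  let K : C ⊗[k] (C ⊗[k] C) →ₗ[k] M ⊗[k] C := sg k (n * u) •
    (TensorProduct.comm k C M).toLinearMap ∘ₗ (TensorProduct.map (sgn 𝒞 (n + u + 1))
      (l.flip m ∘ₗ LinearMap.mul' k A ∘ₗ (TensorProduct.map (φ.comp (sgn 𝒞 q)) ψ)))
  have h1 : Lop 𝒞 ℳ Δ l (conv 𝒞 Δ φ ψ q) (m ⊗ₜ c)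
      = K (TensorProduct.map LinearMap.id Δ (Δ c)) := by
    rw [Lop_apply]
    refine delta_ind 𝒞 hΔgr hc (Gop 𝒞 ℳ l (conv 𝒞 Δ φ ψ q) ∘ₗ TensorProduct.mk k _ _ m)
      (K ∘ₗ TensorProduct.map LinearMap.id Δ) ?_
    intro i j hij a ha b hb
    subst hij
    simp only [LinearMap.comp_apply, TensorProduct.mk_apply, Gop_apply 𝒞 ℳ l _ hm ha hb, K,
      LinearMap.smul_apply, TensorProduct.map_tmul, sgn_apply 𝒞 _ ha, LinearEquiv.coe_coe,
      TensorProduct.comm_tmul, conv_apply, LinearMap.id_apply, LinearMap.flip_apply,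
      TensorProduct.tmul_smul, smul_smul, ← sg_add]
    apply sg_smul_congr
    simp only [Int.even_sub, Int.even_add, Int.even_mul]; grind
  have h2 : Lop 𝒞 ℳ Δ l φ (Lop 𝒞 ℳ Δ l ψ (m ⊗ₜ c))
      = K (TensorProduct.assoc k C C C (TensorProduct.map Δ LinearMap.id (Δ c))) := by
    rw [Lop_apply]
    refine delta_ind 𝒞 hΔgr hc (Lop 𝒞 ℳ Δ l φ ∘ₗ Gop 𝒞 ℳ l ψ ∘ₗ TensorProduct.mk k _ _ m)
      (K ∘ₗ (TensorProduct.assoc k C C C).toLinearMap ∘ₗ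
      TensorProduct.map Δ LinearMap.id) ?_
    intro i j hij a ha b hb
    simp only [LinearMap.comp_apply, TensorProduct.mk_apply, Gop_apply 𝒞 ℳ l _ hm ha hb,
      map_smul, Lop_apply, TensorProduct.map_tmul, LinearMap.id_apply]
    refine delta_ind 𝒞 hΔgr ha (sg k (j * (u + i)) • Gop 𝒞 ℳ l φ ∘ₗ 
        TensorProduct.mk k _ _ (l (ψ b) m))
      (K ∘ₗ (TensorProduct.assoc k C C C).toLinearMap ∘ₗ (TensorProduct.mk k _ _).flip b) ?_
    intro i₁ i₂ hi a₁ ha₁ a₂ ha₂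
    subst hi hij
    simp [K, sgn_apply 𝒞 _ ha₁, sgn_apply 𝒞 _ ha₂, smul_smul, ← sg_add, 
      Gop_apply 𝒞 ℳ l _ (hldeg _ _ _ _ (hψ _ _ hb) hm) ha₁ ha₂, hlmul, ← TensorProduct.smul_tmul']
    apply sg_smul_congr
    simp only [Int.even_sub, Int.even_add, Int.even_mul]; grind
  rw [h1, Module.End.mul_apply, h2, hco]

theorem Rop_mul (𝒞 : ℤ → Submodule k C) [DirectSum.Decomposition 𝒞]
    (ℳ : ℤ → Submodule k M) [DirectSum.Decomposition ℳ]
    {Δ : C →ₗ[k] C ⊗[k] C}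
    (hcoassoc : (TensorProduct.assoc k C C C).toLinearMap.comp
        ((TensorProduct.map Δ LinearMap.id).comp Δ)
      = (TensorProduct.map LinearMap.id Δ).comp Δ)
    (hΔgr : ∀ n : ℤ, ∀ c ∈ 𝒞 n, Δ c ∈
      ⨆ p : ℤ, LinearMap.range (TensorProduct.map (𝒞 p).subtype (𝒞 (n - p)).subtype))
    {r : M →ₗ[k] A →ₗ[k] M}
    (hrmul : ∀ (m : M) (x y : A), r m (x * y) = r (r m x) y)
    (φ ψ : C →ₗ[k] A) (p q : ℤ) :
    Rop 𝒞 Δ r (conv 𝒞 Δ φ ψ q) (p + q) = Rop 𝒞 Δ r ψ q * Rop 𝒞 Δ r φ p := by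
  apply hom_ext2 ℳ 𝒞
  intro u n m hm c hc
  have hco := LinearMap.congr_fun hcoassoc c
  simp only [LinearMap.comp_apply, LinearEquiv.coe_coe] at hco
  let K : C ⊗[k] (C ⊗[k] C) →ₗ[k] M ⊗[k] C := sg k ((p + q) * n) • (TensorProduct.map
      (r m ∘ₗ LinearMap.mul' k A ∘ₗ (TensorProduct.map (φ.comp (sgn 𝒞 q)) ψ)) LinearMap.id)
    ∘ₗ (TensorProduct.assoc k C C C).symm.toLinearMap
  have h1 : Rop 𝒞 Δ r (conv 𝒞 Δ φ ψ q) (p + q) (m ⊗ₜ c)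
      = K (TensorProduct.assoc k C C C (TensorProduct.map Δ LinearMap.id (Δ c))) := by
    rw [Rop_apply 𝒞 Δ r _ _ hc]
    refine delta_ind 𝒞 hΔgr hc
      (sg k ((p + q) * n) • Hop r (conv 𝒞 Δ φ ψ q) ∘ₗ TensorProduct.mk k _ _ m)
      (K ∘ₗ (TensorProduct.assoc k C C C).toLinearMap ∘ₗ
      TensorProduct.map Δ LinearMap.id) ?_
    intro i j hij a ha b hb
    simp [K, Hop_apply, conv_apply]
  have h2 : Rop 𝒞 Δ r ψ q (Rop 𝒞 Δ r φ p (m ⊗ₜ c))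
      = K (TensorProduct.map LinearMap.id Δ (Δ c)) := by
    rw [Rop_apply 𝒞 Δ r _ _ hc]
    refine delta_ind 𝒞 hΔgr hc
      (Rop 𝒞 Δ r ψ q ∘ₗ (sg k (p * n) • Hop r φ ∘ₗ TensorProduct.mk k _ _ m))
      (K ∘ₗ TensorProduct.map LinearMap.id Δ) ?_
    intro i j hij a ha b hb
    simp only [LinearMap.comp_apply, TensorProduct.mk_apply, LinearMap.smul_apply, Hop_apply,
      map_smul, Rop_apply 𝒞 Δ r _ _ hb, TensorProduct.map_tmul, LinearMap.id_apply]
    refine delta_ind 𝒞 hΔgr hb (sg k (p * n) • sg k (q * j) • Hop r ψ ∘ₗ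
        TensorProduct.mk k _ _ (r m (φ a)))
      (K ∘ₗ TensorProduct.mk k _ _ a) ?_
    intro i₁ i₂ hi a₁ ha₁ a₂ ha₂
    subst hi hij
    simp [K, sgn_apply 𝒞 _ ha, smul_smul, ← sg_add, Hop_apply, hrmul, ← TensorProduct.smul_tmul']
    apply sg_smul_congr
    simp only [Int.even_sub, Int.even_add, Int.even_mul]; grind
  rw [h1, Module.End.mul_apply, h2, hco]

theorem Lop_Rop (𝒞 : ℤ → Submodule k C) [DirectSum.Decomposition 𝒞]
    (𝒜 : ℤ → Submodule k A)
    (ℳ : ℤ → Submodule k M) [DirectSum.Decomposition ℳ]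
    {Δ : C →ₗ[k] C ⊗[k] C}
    (hcoassoc : (TensorProduct.assoc k C C C).toLinearMap.comp
        ((TensorProduct.map Δ LinearMap.id).comp Δ)
      = (TensorProduct.map LinearMap.id Δ).comp Δ)
    (hΔgr : ∀ n : ℤ, ∀ c ∈ 𝒞 n, Δ c ∈
      ⨆ p : ℤ, LinearMap.range (TensorProduct.map (𝒞 p).subtype (𝒞 (n - p)).subtype))
    {l : A →ₗ[k] M →ₗ[k] M} {r : M →ₗ[k] A →ₗ[k] M}
    (hlr : ∀ (x y : A) (m : M), l x (r m y) = r (l x m) y)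
    (hrdeg : ∀ (i j : ℤ) (x : A) (m : M), x ∈ 𝒜 i → m ∈ ℳ j → r m x ∈ ℳ (j + i))
    (φ ψ : C →ₗ[k] A) (q : ℤ) (hψ : homDeg 𝒞 𝒜 ψ q) :
    Lop 𝒞 ℳ Δ l φ * Rop 𝒞 Δ r ψ q = Rop 𝒞 Δ r ψ q * Lop 𝒞 ℳ Δ l φ := by
  apply hom_ext2 ℳ 𝒞
  intro u n m hm c hc
  have hco := LinearMap.congr_fun hcoassoc c
  simp only [LinearMap.comp_apply, LinearEquiv.coe_coe] at hco
  let K : C ⊗[k] (C ⊗[k] C) →ₗ[k] M ⊗[k] C := sg k (q * n) •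
    (TensorProduct.map (TensorProduct.lift ((l.flip.compl₂ (φ ∘ₗ sgn 𝒞 (u + q + n + 1))) ∘ₗ
      (r m ∘ₗ ψ))) LinearMap.id)
    ∘ₗ (TensorProduct.assoc k C C C).symm.toLinearMap
    ∘ₗ TensorProduct.map LinearMap.id (TensorProduct.comm k C C).toLinearMap
  have h1 : Rop 𝒞 Δ r ψ q (Lop 𝒞 ℳ Δ l φ (m ⊗ₜ c))
      = K (TensorProduct.assoc k C C C (TensorProduct.map Δ LinearMap.id (Δ c))) := by
    rw [Lop_apply]
    refine delta_ind 𝒞 hΔgr hc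
      (Rop 𝒞 Δ r ψ q ∘ₗ Gop 𝒞 ℳ l φ ∘ₗ TensorProduct.mk k _ _ m)
      (K ∘ₗ (TensorProduct.assoc k C C C).toLinearMap ∘ₗ
      TensorProduct.map Δ LinearMap.id) ?_
    intro i j hij a ha b hb
    simp only [LinearMap.comp_apply, TensorProduct.mk_apply, Gop_apply 𝒞 ℳ l _ hm ha hb,
      map_smul, Rop_apply 𝒞 Δ r _ _ ha, TensorProduct.map_tmul, LinearMap.id_apply]
    refine delta_ind 𝒞 hΔgr ha (sg k (j * (u + i)) • sg k (q * i) • Hop r ψ ∘ₗ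
        TensorProduct.mk k _ _ (l (φ b) m))
      (K ∘ₗ (TensorProduct.assoc k C C C).toLinearMap ∘ₗ (TensorProduct.mk k _ _).flip b) ?_
    intro i₁ i₂ hi a₁ ha₁ a₂ ha₂
    subst hi hij
    simp [K, sgn_apply 𝒞 _ hb, smul_smul, ← sg_add, Hop_apply, hlr, ← TensorProduct.smul_tmul']
    apply sg_smul_congr
    simp only [Int.even_sub, Int.even_add, Int.even_mul]; grind
  have h2 : Lop 𝒞 ℳ Δ l φ (Rop 𝒞 Δ r ψ q (m ⊗ₜ c))
      = K (TensorProduct.map LinearMap.id Δ (Δ c)) := by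
    rw [Rop_apply 𝒞 Δ r _ _ hc]
    refine delta_ind 𝒞 hΔgr hc
      (Lop 𝒞 ℳ Δ l φ ∘ₗ (sg k (q * n) • Hop r ψ ∘ₗ TensorProduct.mk k _ _ m))
      (K ∘ₗ TensorProduct.map LinearMap.id Δ) ?_
    intro i j hij a ha b hb
    simp only [LinearMap.comp_apply, TensorProduct.mk_apply, LinearMap.smul_apply, Hop_apply,
      map_smul, Lop_apply, TensorProduct.map_tmul, LinearMap.id_apply]
    refine delta_ind 𝒞 hΔgr hb (sg k (q * n) • Gop 𝒞 ℳ l φ ∘ₗ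
        TensorProduct.mk k _ _ (r m (ψ a)))
      (K ∘ₗ TensorProduct.mk k _ _ a) ?_
    intro i₁ i₂ hi a₁ ha₁ a₂ ha₂
    subst hi hij
    simp [K, sgn_apply 𝒞 _ ha₂, Gop_apply 𝒞 ℳ l _ (hrdeg _ _ _ _ (hψ _ _ ha) hm) ha₁ ha₂,
      smul_smul, ← sg_add, ← TensorProduct.smul_tmul']
    apply sg_smul_congr
    simp only [Int.even_sub, Int.even_add, Int.even_mul]; grind
  rw [Module.End.mul_apply, Module.End.mul_apply, h1, h2, hco]

theorem Lop_one (𝒞 : ℤ → Submodule k C) [DirectSum.Decomposition 𝒞]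
    (ℳ : ℤ → Submodule k M) [DirectSum.Decomposition ℳ]
    {Δ : C →ₗ[k] C ⊗[k] C} {εC : C →ₗ[k] k}
    (hcounitr : (TensorProduct.rid k C).toLinearMap.comp
        ((TensorProduct.map LinearMap.id εC).comp Δ) = LinearMap.id)
    (hΔgr : ∀ n : ℤ, ∀ c ∈ 𝒞 n, Δ c ∈
      ⨆ p : ℤ, LinearMap.range (TensorProduct.map (𝒞 p).subtype (𝒞 (n - p)).subtype))
    (hεC0 : ∀ i : ℤ, i ≠ 0 → ∀ c ∈ 𝒞 i, εC c = 0)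
    {l : A →ₗ[k] M →ₗ[k] M} (hl1 : ∀ m : M, l 1 m = m) :
    Lop 𝒞 ℳ Δ l ((Algebra.linearMap k A).comp εC) = 1 := by
  apply hom_ext2 ℳ 𝒞
  intro u n m hm c hc
  have hco := LinearMap.congr_fun hcounitr c
  simp only [LinearMap.comp_apply, LinearEquiv.coe_coe, LinearMap.id_apply] at hco
  conv_rhs => rw [← hco]
  rw [Lop_apply]
  refine delta_ind 𝒞 hΔgr hc (Gop 𝒞 ℳ l _ ∘ₗ TensorProduct.mk k _ _ m)
    (TensorProduct.mk k _ _ m ∘ₗ (TensorProduct.rid k C).toLinearMap ∘ₗ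
      TensorProduct.map LinearMap.id εC) ?_
  intro i j hij a ha b hb
  by_cases hj : j = 0
  · subst hj
    simp [Gop_apply 𝒞 ℳ l _ hm ha hb, sg_zero, Algebra.algebraMap_eq_smul_one, hl1,
      TensorProduct.smul_tmul']
  · simp [Gop_apply 𝒞 ℳ l _ hm ha hb, hεC0 j hj b hb]

theorem Rop_one (𝒞 : ℤ → Submodule k C) [DirectSum.Decomposition 𝒞]
    (ℳ : ℤ → Submodule k M) [DirectSum.Decomposition ℳ]
    {Δ : C →ₗ[k] C ⊗[k] C} {εC : C →ₗ[k] k}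
    (hcounitl : (TensorProduct.lid k C).toLinearMap.comp
        ((TensorProduct.map εC LinearMap.id).comp Δ) = LinearMap.id)
    (hΔgr : ∀ n : ℤ, ∀ c ∈ 𝒞 n, Δ c ∈
      ⨆ p : ℤ, LinearMap.range (TensorProduct.map (𝒞 p).subtype (𝒞 (n - p)).subtype))
    {r : M →ₗ[k] A →ₗ[k] M} (hr1 : ∀ m : M, r m 1 = m) :
    Rop 𝒞 Δ r ((Algebra.linearMap k A).comp εC) 0 = 1 := by
  apply hom_ext2 ℳ 𝒞
  intro u n m hm c hc
  have hco := LinearMap.congr_fun hcounitl c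
  simp only [LinearMap.comp_apply, LinearEquiv.coe_coe, LinearMap.id_apply] at hco
  conv_rhs => rw [← hco]
  rw [Rop_apply 𝒞 Δ r _ _ hc]
  refine delta_ind 𝒞 hΔgr hc (sg k (0 * n) • Hop r _ ∘ₗ TensorProduct.mk k _ _ m)
    (TensorProduct.mk k _ _ m ∘ₗ (TensorProduct.lid k C).toLinearMap ∘ₗ
      TensorProduct.map εC LinearMap.id) ?_
  intro i j hij a ha b hb
  simp [Hop_apply, sg_zero, Algebra.algebraMap_eq_smul_one, hr1, TensorProduct.smul_tmul']

theorem sMC_Lop (𝒞 : ℤ → Submodule k C) [DirectSum.Decomposition 𝒞]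
    (𝒜 : ℤ → Submodule k A)
    (ℳ : ℤ → Submodule k M) [DirectSum.Decomposition ℳ]
    {Δ : C →ₗ[k] C ⊗[k] C}
    (hΔgr : ∀ n : ℤ, ∀ c ∈ 𝒞 n, Δ c ∈
      ⨆ p : ℤ, LinearMap.range (TensorProduct.map (𝒞 p).subtype (𝒞 (n - p)).subtype))
    {l : A →ₗ[k] M →ₗ[k] M}
    (hldeg : ∀ (i j : ℤ) (x : A) (m : M), x ∈ 𝒜 i → m ∈ ℳ j → l x m ∈ ℳ (i + j))
    (φ : C →ₗ[k] A) (p : ℤ) (hφ : homDeg 𝒞 𝒜 φ p)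
    (s : Module.End k (M ⊗[k] C)) (hs : s = TensorProduct.map (sgn ℳ 1) (sgn 𝒞 1)) :
    s * Lop 𝒞 ℳ Δ l φ = sg k p • (Lop 𝒞 ℳ Δ l φ * s) := by
  apply hom_ext2 ℳ 𝒞
  intro u n m hm c hc
  simp only [hs, Module.End.mul_apply, LinearMap.smul_apply, TensorProduct.map_tmul,
    sgn_apply ℳ _ hm, sgn_apply 𝒞 _ hc, Lop_apply, TensorProduct.tmul_smul,
    ← TensorProduct.smul_tmul', map_smul, smul_smul, ← sg_add]
  refine delta_ind 𝒞 hΔgr hc (TensorProduct.map (sgn ℳ 1) (sgn 𝒞 1) ∘ₗ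
      Gop 𝒞 ℳ l _ ∘ₗ TensorProduct.mk k _ _ m)
    (sg k (p + (1 * n + 1 * u)) • Gop 𝒞 ℳ l _ ∘ₗ TensorProduct.mk k _ _ m) ?_
  intro i j hij a ha b hb
  subst hij
  simp [Gop_apply 𝒞 ℳ l _ hm ha hb, sgn_apply ℳ _ (hldeg _ _ _ _ (hφ _ _ hb) hm),
    sgn_apply 𝒞 _ ha, smul_smul, ← sg_add, ← TensorProduct.smul_tmul']
  apply sg_smul_congr
  simp only [Int.even_sub, Int.even_add, Int.even_mul]; grind

theorem sMC_Rop (𝒞 : ℤ → Submodule k C) [DirectSum.Decomposition 𝒞]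
    (𝒜 : ℤ → Submodule k A)
    (ℳ : ℤ → Submodule k M) [DirectSum.Decomposition ℳ]
    {Δ : C →ₗ[k] C ⊗[k] C}
    (hΔgr : ∀ n : ℤ, ∀ c ∈ 𝒞 n, Δ c ∈
      ⨆ p : ℤ, LinearMap.range (TensorProduct.map (𝒞 p).subtype (𝒞 (n - p)).subtype))
    {r : M →ₗ[k] A →ₗ[k] M}
    (hrdeg : ∀ (i j : ℤ) (x : A) (m : M), x ∈ 𝒜 i → m ∈ ℳ j → r m x ∈ ℳ (j + i))
    (φ : C →ₗ[k] A) (p : ℤ) (hφ : homDeg 𝒞 𝒜 φ p)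
    (s : Module.End k (M ⊗[k] C)) (hs : s = TensorProduct.map (sgn ℳ 1) (sgn 𝒞 1)) :
    s * Rop 𝒞 Δ r φ p = sg k p • (Rop 𝒞 Δ r φ p * s) := by
  apply hom_ext2 ℳ 𝒞
  intro u n m hm c hc
  simp only [hs, Module.End.mul_apply, LinearMap.smul_apply, TensorProduct.map_tmul,
    sgn_apply ℳ _ hm, sgn_apply 𝒞 _ hc, Rop_apply 𝒞 Δ r _ _ hc, TensorProduct.tmul_smul,
    ← TensorProduct.smul_tmul', map_smul, smul_smul, ← sg_add]
  refine delta_ind 𝒞 hΔgr hc (sg k (p * n) • TensorProduct.map (sgn ℳ 1) (sgn 𝒞 1) ∘ₗ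
      Hop r _ ∘ₗ TensorProduct.mk k _ _ m)
    (sg k (p + (1 * n + 1 * u + p * n)) • Hop r _ ∘ₗ TensorProduct.mk k _ _ m) ?_
  intro i j hij a ha b hb
  subst hij
  simp [Hop_apply, sgn_apply ℳ _ (hrdeg _ _ _ _ (hφ _ _ ha) hm),
    sgn_apply 𝒞 _ hb, smul_smul, ← sg_add, ← TensorProduct.smul_tmul']
  apply sg_smul_congr
  simp only [Int.even_sub, Int.even_add, Int.even_mul]; grind

set_option maxHeartbeats 4000000 in
theorem d_Lop (𝒞 : ℤ → Submodule k C) [DirectSum.Decomposition 𝒞]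
    (𝒜 : ℤ → Submodule k A)
    (ℳ : ℤ → Submodule k M) [DirectSum.Decomposition ℳ]
    {Δ : C →ₗ[k] C ⊗[k] C} {dC : C →ₗ[k] C} {dA : A →ₗ[k] A} {dM : M →ₗ[k] M}
    (hΔgr : ∀ n : ℤ, ∀ c ∈ 𝒞 n, Δ c ∈
      ⨆ p : ℤ, LinearMap.range (TensorProduct.map (𝒞 p).subtype (𝒞 (n - p)).subtype))
    (hdCdeg : ∀ i : ℤ, ∀ c ∈ 𝒞 i, dC c ∈ 𝒞 (i + 1))
    (hcoder : Δ.comp dC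
      = (TensorProduct.map dC LinearMap.id + TensorProduct.map (sgn 𝒞 1) dC).comp Δ)
    {l : A →ₗ[k] M →ₗ[k] M}
    (hldeg : ∀ (i j : ℤ) (x : A) (m : M), x ∈ 𝒜 i → m ∈ ℳ j → l x m ∈ ℳ (i + j))
    (hMdeg : ∀ j : ℤ, ∀ m ∈ ℳ j, dM m ∈ ℳ (j + 1))
    (hMleibl : ∀ (i : ℤ) (x : A) (m : M), x ∈ 𝒜 i →
      dM (l x m) = l (dA x) m + (Int.negOnePow i) • l x (dM m))
    (φ : C →ₗ[k] A) (p : ℤ) (hφ : homDeg 𝒞 𝒜 φ p)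
    (d : Module.End k (M ⊗[k] C))
    (hd : d = TensorProduct.map dM LinearMap.id + TensorProduct.map (sgn ℳ 1) dC) :
    d * Lop 𝒞 ℳ Δ l φ = Lop 𝒞 ℳ Δ l (dconv dC dA φ p) + sg k p • (Lop 𝒞 ℳ Δ l φ * d) := by
  apply hom_ext2 ℳ 𝒞
  intro u n m hm c hc
  have hco := LinearMap.congr_fun hcoder c
  simp only [LinearMap.comp_apply] at hco
  simp only [hd, Module.End.mul_apply, LinearMap.smul_apply, TensorProduct.map_tmul,
    sgn_apply ℳ _ hm, Lop_apply, TensorProduct.tmul_smul, LinearMap.add_apply, LinearMap.id_apply,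
    ← TensorProduct.smul_tmul', map_smul, smul_smul, ← sg_add, hco, map_add]
  refine delta_ind 𝒞 hΔgr hc
    ((TensorProduct.map dM LinearMap.id + TensorProduct.map (sgn ℳ 1) dC) ∘ₗ
      Gop 𝒞 ℳ l _ ∘ₗ TensorProduct.mk k _ _ m)
    (Gop 𝒞 ℳ l (dconv dC dA φ p) ∘ₗ TensorProduct.mk k _ _ m + sg k p •
      (Gop 𝒞 ℳ l _ ∘ₗ TensorProduct.mk k _ _ (dM m) + 
       sg k (1 * u) • (Gop 𝒞 ℳ l _ ∘ₗ TensorProduct.mk k _ _ m ∘ₗ 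
        (TensorProduct.map dC LinearMap.id + TensorProduct.map (sgn 𝒞 1) dC)))) ?_
  intro i j hij a ha b hb
  subst hij
  simp [Gop_apply 𝒞 ℳ l _ hm ha hb, Gop_apply 𝒞 ℳ l _ (hMdeg _ _ hm) ha hb,
    Gop_apply 𝒞 ℳ l _ hm (hdCdeg _ _ ha) hb, Gop_apply 𝒞 ℳ l _ hm ha (hdCdeg _ _ hb),
    sgn_apply ℳ _ (hldeg _ _ _ _ (hφ _ _ hb) hm), hMleibl _ _ _ (hφ _ _ hb), dconv,
    unit_smul_sg (k := k), TensorProduct.add_tmul, TensorProduct.sub_tmul, smul_sub,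
    TensorProduct.tmul_add, 
    sgn_apply 𝒞 _ ha, smul_smul, ← sg_add, ← TensorProduct.smul_tmul']
  match_scalars <;> simp only [mul_one, mul_neg, sg_neg', ← sg_add] <;>
    first | apply sg_congr | (rw [eq_comm, add_eq_zero_iff_eq_neg, sg_neg']; apply sg_congr)
  all_goals (simp only [Int.even_sub, Int.even_add, Int.even_mul]; grind)

set_option maxHeartbeats 4000000 in
theorem d_Rop (𝒞 : ℤ → Submodule k C) [DirectSum.Decomposition 𝒞]
    (𝒜 : ℤ → Submodule k A)
    (ℳ : ℤ → Submodule k M) [DirectSum.Decomposition ℳ]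
    {Δ : C →ₗ[k] C ⊗[k] C} {dC : C →ₗ[k] C} {dA : A →ₗ[k] A} {dM : M →ₗ[k] M}
    (hΔgr : ∀ n : ℤ, ∀ c ∈ 𝒞 n, Δ c ∈
      ⨆ p : ℤ, LinearMap.range (TensorProduct.map (𝒞 p).subtype (𝒞 (n - p)).subtype))
    (hdCdeg : ∀ i : ℤ, ∀ c ∈ 𝒞 i, dC c ∈ 𝒞 (i + 1))
    (hcoder : Δ.comp dC
      = (TensorProduct.map dC LinearMap.id + TensorProduct.map (sgn 𝒞 1) dC).comp Δ)
    {r : M →ₗ[k] A →ₗ[k] M}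
    (hrdeg : ∀ (i j : ℤ) (x : A) (m : M), x ∈ 𝒜 i → m ∈ ℳ j → r m x ∈ ℳ (j + i))
    (hMleibr : ∀ (j : ℤ) (m : M) (x : A), m ∈ ℳ j →
      dM (r m x) = r (dM m) x + (Int.negOnePow j) • r m (dA x))
    (φ : C →ₗ[k] A) (p : ℤ) (hφ : homDeg 𝒞 𝒜 φ p)
    (d s : Module.End k (M ⊗[k] C))
    (hd : d = TensorProduct.map dM LinearMap.id + TensorProduct.map (sgn ℳ 1) dC)
    (hs : s = TensorProduct.map (sgn ℳ 1) (sgn 𝒞 1)) :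
    d * Rop 𝒞 Δ r φ p = Rop 𝒞 Δ r φ p * d + Rop 𝒞 Δ r (dconv dC dA φ p) (p + 1) * s := by
  apply hom_ext2 ℳ 𝒞
  intro u n m hm c hc
  have hco := LinearMap.congr_fun hcoder c
  simp only [LinearMap.comp_apply] at hco
  simp only [hd, hs, Module.End.mul_apply, LinearMap.smul_apply, TensorProduct.map_tmul,
    sgn_apply ℳ _ hm, sgn_apply 𝒞 _ hc, Rop_apply 𝒞 Δ r _ _ hc, Rop_apply 𝒞 Δ r _ _ (hdCdeg _ _ hc),
    TensorProduct.tmul_smul, LinearMap.add_apply, LinearMap.id_apply,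
    ← TensorProduct.smul_tmul', map_smul, smul_smul, ← sg_add, hco, map_add, smul_add]
  refine delta_ind 𝒞 hΔgr hc
    (sg k (p * n) • (TensorProduct.map dM LinearMap.id ∘ₗ Hop r φ ∘ₗ TensorProduct.mk k _ _ m) +
     sg k (p * n) • (TensorProduct.map (sgn ℳ 1) dC ∘ₗ Hop r φ ∘ₗ TensorProduct.mk k _ _ m))
    (sg k (p * n) • (Hop r φ ∘ₗ TensorProduct.mk k _ _ (dM m)) + 
       sg k (1 * u + p * (n + 1)) • (Hop r φ ∘ₗ TensorProduct.mk k _ _ m ∘ₗ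
        (TensorProduct.map dC LinearMap.id + TensorProduct.map (sgn 𝒞 1) dC)) +
       sg k (1 * n + 1 * u + (p + 1) * n) •
        (Hop r (dconv dC dA φ p) ∘ₗ TensorProduct.mk k _ _ m)) ?_
  intro i j hij a ha b hb
  subst hij
  simp [Hop_apply, 
    sgn_apply ℳ _ (hrdeg _ _ _ _ (hφ _ _ ha) hm), hMleibr _ _ _ hm, dconv,
    unit_smul_sg (k := k), TensorProduct.add_tmul, TensorProduct.sub_tmul, smul_sub,
    TensorProduct.tmul_add, 
    sgn_apply 𝒞 _ ha, smul_smul, ← sg_add, ← TensorProduct.smul_tmul']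
  match_scalars <;> simp only [mul_one, mul_neg, sg_neg', ← sg_add] <;>
    first | apply sg_congr | (rw [eq_comm, add_eq_zero_iff_eq_neg, sg_neg']; apply sg_congr)
  all_goals (simp only [Int.even_sub, Int.even_add, Int.even_mul]; grind)

theorem s_s (𝒞 : ℤ → Submodule k C) [DirectSum.Decomposition 𝒞]
    (ℳ : ℤ → Submodule k M) [DirectSum.Decomposition ℳ]
    (s : Module.End k (M ⊗[k] C))
    (hs : s = TensorProduct.map (sgn ℳ 1) (sgn 𝒞 1)) : s * s = 1 := by
  apply hom_ext2 ℳ 𝒞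
  intro u n m hm c hc
  simp [hs, sgn_apply ℳ _ hm, sgn_apply 𝒞 _ hc, smul_smul, ← sg_add, ← TensorProduct.smul_tmul']
  conv_rhs => rw [← one_smul k (m ⊗ₜ[k] c), ← sg_zero]
  apply sg_smul_congr
  simp only [Int.even_sub, Int.even_add, Int.even_mul]; grind

theorem s_d (𝒞 : ℤ → Submodule k C) [DirectSum.Decomposition 𝒞]
    (ℳ : ℤ → Submodule k M) [DirectSum.Decomposition ℳ]
    {dC : C →ₗ[k] C} {dM : M →ₗ[k] M}
    (hdCdeg : ∀ i : ℤ, ∀ c ∈ 𝒞 i, dC c ∈ 𝒞 (i + 1))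
    (hMdeg : ∀ j : ℤ, ∀ m ∈ ℳ j, dM m ∈ ℳ (j + 1))
    (d s : Module.End k (M ⊗[k] C))
    (hd : d = TensorProduct.map dM LinearMap.id + TensorProduct.map (sgn ℳ 1) dC)
    (hs : s = TensorProduct.map (sgn ℳ 1) (sgn 𝒞 1)) : s * d = - (d * s) := by
  apply hom_ext2 ℳ 𝒞
  intro u n m hm c hc
  simp [hs, hd, sgn_apply ℳ _ hm, sgn_apply 𝒞 _ hc, sgn_apply ℳ _ (hMdeg _ _ hm),
    sgn_apply 𝒞 _ (hdCdeg _ _ hc), smul_smul, ← sg_add, ← TensorProduct.smul_tmul']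
  match_scalars <;> simp only [mul_one, mul_neg, sg_neg', ← sg_add] <;>
    first | apply sg_congr | (rw [eq_comm, add_eq_zero_iff_eq_neg, sg_neg']; apply sg_congr)
  all_goals (simp only [Int.even_sub, Int.even_add, Int.even_mul]; grind)

theorem d_d (𝒞 : ℤ → Submodule k C) [DirectSum.Decomposition 𝒞]
    (ℳ : ℤ → Submodule k M) [DirectSum.Decomposition ℳ]
    {dC : C →ₗ[k] C} {dM : M →ₗ[k] M}
    (hdCsq : ∀ c : C, dC (dC c) = 0)
    (hMsq : ∀ m : M, dM (dM m) = 0)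
    (hMdeg : ∀ j : ℤ, ∀ m ∈ ℳ j, dM m ∈ ℳ (j + 1))
    (d : Module.End k (M ⊗[k] C))
    (hd : d = TensorProduct.map dM LinearMap.id + TensorProduct.map (sgn ℳ 1) dC) :
    d * d = 0 := by
  apply hom_ext2 ℳ 𝒞
  intro u n m hm c hc
  simp [hd, sgn_apply ℳ _ hm, sgn_apply ℳ _ (hMdeg _ _ hm), hdCsq, hMsq,
    smul_smul, ← sg_add, ← TensorProduct.smul_tmul']
  rw [← add_smul, sg_add]
  simp [sg_one]

theorem lift_add {X Y Z : Type} [AddCommGroup X] [Module k X] [AddCommGroup Y] [Module k Y]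
    [AddCommGroup Z] [Module k Z] (f g : X →ₗ[k] Y →ₗ[k] Z) :
    TensorProduct.lift (f + g) = TensorProduct.lift f + TensorProduct.lift g := by
  ext; simp

theorem lift_smul {X Y Z : Type} [AddCommGroup X] [Module k X] [AddCommGroup Y] [Module k Y]
    [AddCommGroup Z] [Module k Z] (x : k) (f : X →ₗ[k] Y →ₗ[k] Z) :
    TensorProduct.lift (x • f) = x • TensorProduct.lift f := by
  ext; simp

theorem Lop_add (𝒞 : ℤ → Submodule k C) [DirectSum.Decomposition 𝒞]
    (ℳ : ℤ → Submodule k M) [DirectSum.Decomposition ℳ] (Δ : C →ₗ[k] C ⊗[k] C)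
    (l : A →ₗ[k] M →ₗ[k] M) (φ ψ : C →ₗ[k] A) :
    Lop 𝒞 ℳ Δ l (φ + ψ) = Lop 𝒞 ℳ Δ l φ + Lop 𝒞 ℳ Δ l ψ := by
  simp [Lop, Gop, LinearMap.comp_add, lift_add, TensorProduct.map_add_left,
    LinearMap.add_comp]

theorem Lop_smul (𝒞 : ℤ → Submodule k C) [DirectSum.Decomposition 𝒞]
    (ℳ : ℤ → Submodule k M) [DirectSum.Decomposition ℳ] (Δ : C →ₗ[k] C ⊗[k] C)
    (l : A →ₗ[k] M →ₗ[k] M) (x : k) (φ : C →ₗ[k] A) :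
    Lop 𝒞 ℳ Δ l (x • φ) = x • Lop 𝒞 ℳ Δ l φ := by
  simp [Lop, Gop, LinearMap.comp_smul, lift_smul, TensorProduct.map_smul_left,
    LinearMap.smul_comp]

theorem Rop_add (𝒞 : ℤ → Submodule k C) [DirectSum.Decomposition 𝒞]
    (Δ : C →ₗ[k] C ⊗[k] C)
    (r : M →ₗ[k] A →ₗ[k] M) (φ ψ : C →ₗ[k] A) (q : ℤ) :
    Rop 𝒞 Δ r (φ + ψ) q = Rop 𝒞 Δ r φ q + Rop 𝒞 Δ r ψ q := by
  have : r.compl₂ (φ + ψ) = r.compl₂ φ + r.compl₂ ψ := by ext; simp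
  simp [Rop, Hop, this, lift_add, TensorProduct.map_add_left,
    LinearMap.add_comp]

theorem Rop_smul (𝒞 : ℤ → Submodule k C) [DirectSum.Decomposition 𝒞]
    (Δ : C →ₗ[k] C ⊗[k] C)
    (r : M →ₗ[k] A →ₗ[k] M) (x : k) (φ : C →ₗ[k] A) (q : ℤ) :
    Rop 𝒞 Δ r (x • φ) q = x • Rop 𝒞 Δ r φ q := by
  have : r.compl₂ (x • φ) = x • r.compl₂ φ := by ext; simp
  simp [Rop, Hop, this, lift_smul, TensorProduct.map_smul_left,
    LinearMap.smul_comp]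

theorem conv_add_left (𝒞 : ℤ → Submodule k C) [DirectSum.Decomposition 𝒞]
    (Δ : C →ₗ[k] C ⊗[k] C) (φ φ' ψ : C →ₗ[k] A) (q : ℤ) :
    conv 𝒞 Δ (φ + φ') ψ q = conv 𝒞 Δ φ ψ q + conv 𝒞 Δ φ' ψ q := by
  simp [conv, LinearMap.add_comp, LinearMap.comp_add, TensorProduct.map_add_left]

theorem conv_add_right (𝒞 : ℤ → Submodule k C) [DirectSum.Decomposition 𝒞]
    (Δ : C →ₗ[k] C ⊗[k] C) (φ φ' ψ : C →ₗ[k] A) (q : ℤ) :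
    conv 𝒞 Δ ψ (φ + φ') q = conv 𝒞 Δ ψ φ q + conv 𝒞 Δ ψ φ' q := by
  simp [conv, LinearMap.add_comp, LinearMap.comp_add, TensorProduct.map_add_right]

theorem conv_smul_left (𝒞 : ℤ → Submodule k C) [DirectSum.Decomposition 𝒞]
    (Δ : C →ₗ[k] C ⊗[k] C) (x : k) (φ ψ : C →ₗ[k] A) (q : ℤ) :
    conv 𝒞 Δ (x • φ) ψ q = x • conv 𝒞 Δ φ ψ q := by
  simp [conv, LinearMap.smul_comp, LinearMap.comp_smul, TensorProduct.map_smul_left]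

theorem conv_smul_right (𝒞 : ℤ → Submodule k C) [DirectSum.Decomposition 𝒞]
    (Δ : C →ₗ[k] C ⊗[k] C) (x : k) (φ ψ : C →ₗ[k] A) (q : ℤ) :
    conv 𝒞 Δ ψ (x • φ) q = x • conv 𝒞 Δ ψ φ q := by
  simp [conv, LinearMap.smul_comp, LinearMap.comp_smul, TensorProduct.map_smul_right]

theorem dconv_add (dC : C →ₗ[k] C) (dA : A →ₗ[k] A) (φ ψ : C →ₗ[k] A) (p : ℤ) :
    dconv dC dA (φ + ψ) p = dconv dC dA φ p + dconv dC dA ψ p := by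
  ext; simp [dconv]; abel

theorem dconv_smul (dC : C →ₗ[k] C) (dA : A →ₗ[k] A) (x : k) (φ : C →ₗ[k] A) (p : ℤ) :
    dconv dC dA (x • φ) p = x • dconv dC dA φ p := by
  ext; simp [dconv, unit_smul_sg (k := k), smul_sub, smul_smul, mul_comm]

theorem dconv_sq {dC : C →ₗ[k] C} {dA : A →ₗ[k] A}
    (hdCsq : ∀ c : C, dC (dC c) = 0) (hdAsq : ∀ x : A, dA (dA x) = 0)
    (φ : C →ₗ[k] A) (p : ℤ) :
    dconv dC dA (dconv dC dA φ p) (p + 1) = 0 := by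
  ext; simp [dconv, unit_smul_sg (k := k), hdCsq, hdAsq, sg_add, sg_one]

theorem sg_cases (p : ℤ) : sg k p = 1 ∨ sg k p = -1 := by
  rcases Int.units_eq_one_or p.negOnePow with h | h <;> simp [sg, h]

theorem alg_sq {k R : Type} [CommRing k] [Ring R] [Algebra k R] (d s T U : R)
    (a1 : d * d = 0) (a2 : s * d = -(d * s)) (a3 : s * s = 1)
    (a4 : d * T = (-1 : k) • (T * T) + (-1 : k) • (T * d))
    (a5 : d * U = U * d + ((-1 : k) • (U * U)) * s)
    (a8 : T * U = U * T) (a9 : s * T = (-1 : k) • (T * s)) (a10 : s * U = (-1 : k) • (U * s)) :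
    (d + T - U * s) * (d + T - U * s) = 0 := by
  simp only [neg_smul, one_smul] at a4 a5 a9 a10
  have b1 : U * s * d = - (U * d * s) := by rw [mul_assoc, a2]; noncomm_ring
  have b2 : U * s * T = - (T * U * s) := by rw [mul_assoc, a9, a8]; simp [mul_assoc]
  have b3 : U * s * (U * s) = - (U * U) := by
    rw [mul_assoc, ← mul_assoc s, a10]; simp [mul_assoc, a3]
  have b4 : d * (U * s) = U * d * s - U * U := by
    rw [← mul_assoc, a5]; simp [add_mul, mul_assoc, a3]; abel
  have : (d + T - U * s) * (d + T - U * s) = d * d + d * T + T * d + T * T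
      - d * (U * s) - T * U * s - U * s * d - U * s * T + U * s * (U * s) := by
    noncomm_ring
  rw [this, b1, b2, b3, b4, a1, a4]
  abel

theorem alg_leib {k R : Type} [CommRing k] [Ring R] [Algebra k R] (d s T U F G F' G' : R)
    (e e' : k) (he : e = 1 ∨ e = -1) (he' : e' = 1 ∨ e' = -1)
    (a4 : d * F = F' + e • (F * d)) (a5 : d * G = G * d + G' * s)
    (a8 : F * U = U * F) (a8' : T * G = G * T)
    (a9 : s * F = e • (F * s)) (a10 : s * G = e' • (G * s)) :
    (d + T - U * s) * (F * G) = (F' + T * F + (-e) • (F * T)) * G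
      + e • ((F * G) * (d + T - U * s))
      + e • ((F * (G' + G * U + (-e') • (U * G))) * s) := by
  have b1 : d * (F * G) = F' * G + e • (F * (G * d)) + e • (F * (G' * s)) := by
    rw [← mul_assoc, a4, add_mul, smul_mul_assoc, mul_assoc, a5, mul_add, smul_add, add_assoc]
  have b2 : U * s * (F * G) = (e * e') • (F * (U * (G * s))) := by
    rw [mul_assoc, ← mul_assoc s, a9, smul_mul_assoc, mul_assoc, a10, mul_smul_comm,
      mul_smul_comm, mul_smul_comm, ← mul_assoc U, ← a8, smul_smul, mul_assoc]
  simp only [sub_mul, add_mul, mul_add, mul_sub, smul_mul_assoc, mul_smul_comm, b2]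
  rw [b1]
  simp only [mul_assoc, a8']
  rcases he with h | h <;> rcases he' with h' | h' <;> rw [h, h'] <;> module

end helpers

theorem statement7 {k C A M : Type} [CommRing k]
    [AddCommGroup C] [Module k C] [Ring A] [Algebra k A]
    [AddCommGroup M] [Module k M]
    (𝒞 : ℤ → Submodule k C) [DirectSum.Decomposition 𝒞]
    (𝒜 : ℤ → Submodule k A) [GradedAlgebra 𝒜]
    (ℳ : ℤ → Submodule k M) [DirectSum.Decomposition ℳ]
    -- the coaugmented dg coalgebra structure of `C`
    (Δ : C →ₗ[k] C ⊗[k] C) (εC : C →ₗ[k] k) (ηC : k →ₗ[k] C) (dC : C →ₗ[k] C)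
    (hcoassoc : (TensorProduct.assoc k C C C).toLinearMap.comp
        ((TensorProduct.map Δ LinearMap.id).comp Δ)
      = (TensorProduct.map LinearMap.id Δ).comp Δ)
    (hcounitl : (TensorProduct.lid k C).toLinearMap.comp
        ((TensorProduct.map εC LinearMap.id).comp Δ) = LinearMap.id)
    (hcounitr : (TensorProduct.rid k C).toLinearMap.comp
        ((TensorProduct.map LinearMap.id εC).comp Δ) = LinearMap.id)
    (hΔgr : ∀ n : ℤ, ∀ c ∈ 𝒞 n, Δ c ∈
      ⨆ p : ℤ, LinearMap.range (TensorProduct.map (𝒞 p).subtype (𝒞 (n - p)).subtype))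
    (hεC0 : ∀ i : ℤ, i ≠ 0 → ∀ c ∈ 𝒞 i, εC c = 0)
    (hdCdeg : ∀ i : ℤ, ∀ c ∈ 𝒞 i, dC c ∈ 𝒞 (i + 1))
    (hdCsq : ∀ c : C, dC (dC c) = 0)
    (hcoder : Δ.comp dC
      = (TensorProduct.map dC LinearMap.id + TensorProduct.map (sgn 𝒞 1) dC).comp Δ)
    (hεCd : ∀ c : C, εC (dC c) = 0)
    (hηgr : ηC 1 ∈ 𝒞 0) (hεη : εC (ηC 1) = 1)
    (hΔη : Δ (ηC 1) = ηC 1 ⊗ₜ[k] ηC 1) (hdη : dC (ηC 1) = 0)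
    -- the augmented dg algebra structure of `A`
    (dA : A →ₗ[k] A)
    (hdAdeg : ∀ i : ℤ, ∀ x ∈ 𝒜 i, dA x ∈ 𝒜 (i + 1))
    (hdAsq : ∀ x : A, dA (dA x) = 0)
    (hdAleib : ∀ i : ℤ, ∀ x ∈ 𝒜 i, ∀ y : A,
      dA (x * y) = dA x * y + (Int.negOnePow i) • (x * dA y))
    (εA : A →ₐ[k] k)
    (hεA0 : ∀ i : ℤ, i ≠ 0 → ∀ x ∈ 𝒜 i, εA x = 0)
    (hεAd : ∀ x : A, εA (dA x) = 0)
    -- the dg `A`-bimodule structure of `M`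
    (l : A →ₗ[k] M →ₗ[k] M) (r : M →ₗ[k] A →ₗ[k] M)
    (hl1 : ∀ m : M, l 1 m = m)
    (hlmul : ∀ (x y : A) (m : M), l (x * y) m = l x (l y m))
    (hr1 : ∀ m : M, r m 1 = m)
    (hrmul : ∀ (m : M) (x y : A), r m (x * y) = r (r m x) y)
    (hlr : ∀ (x y : A) (m : M), l x (r m y) = r (l x m) y)
    (hldeg : ∀ (i j : ℤ) (x : A) (m : M), x ∈ 𝒜 i → m ∈ ℳ j → l x m ∈ ℳ (i + j))
    (hrdeg : ∀ (i j : ℤ) (x : A) (m : M), x ∈ 𝒜 i → m ∈ ℳ j → r m x ∈ ℳ (j + i))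
    (dM : M →ₗ[k] M)
    (hMdeg : ∀ j : ℤ, ∀ m ∈ ℳ j, dM m ∈ ℳ (j + 1))
    (hMsq : ∀ m : M, dM (dM m) = 0)
    (hMleibl : ∀ (i : ℤ) (x : A) (m : M), x ∈ 𝒜 i →
      dM (l x m) = l (dA x) m + (Int.negOnePow i) • l x (dM m))    (hMleibr : ∀ (j : ℤ) (m : M) (x : A), m ∈ ℳ j →
      dM (r m x) = r (dM m) x + (Int.negOnePow j) • r m (dA x))
    -- the twisting cochain τ : a degree-1 Maurer–Cartan element of Hom(C,A)
    -- with ε_A ∘ τ = 0 and τ ∘ η_C = 0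
    (τ : C →ₗ[k] A)
    (hτdeg : homDeg 𝒞 𝒜 τ 1)
    (hτMC : dconv dC dA τ 1 + conv 𝒞 Δ τ τ 1 = 0)
    (hτε : ∀ c : C, εA (τ c) = 0)
    (hτη : τ (ηC 1) = 0) :
    -- notation: `one` is the convolution unit, `act` the two-sided action,
    -- `dMC`/`sMC` as before, `dτ` the twisted differential of Hom^τ(C,A) and
    -- `DMC` the twisted differential of M ⊗_τ C
    ∀ one act dMC sMC
      (dτ : (C →ₗ[k] A) → ℤ → (C →ₗ[k] A)) (DMC : M ⊗[k] C →ₗ[k] M ⊗[k] C),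
      one = (Algebra.linearMap k A).comp εC →
      act = hact 𝒞 ℳ Δ l r →
      dMC = TensorProduct.map dM LinearMap.id + TensorProduct.map (sgn ℳ 1) dC →
      sMC = TensorProduct.map (sgn ℳ 1) (sgn 𝒞 1) →
      (∀ (f : C →ₗ[k] A) (p : ℤ),
        dτ f p = dconv dC dA f p + conv 𝒞 Δ τ f p
          - (Int.negOnePow p) • conv 𝒞 Δ f τ 1) →
      DMC = dMC + act τ one 0 - (act one τ 1).comp sMC →
      -- `Hom^τ(C,A)` is a dg algebra: the twisted differential squares to zero and
      -- satisfies the graded Leibniz rule for the convolution product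
      (∀ (p : ℤ) (φ : C →ₗ[k] A), homDeg 𝒞 𝒜 φ p → dτ (dτ φ p) (p + 1) = 0) ∧
      (∀ (p q : ℤ) (φ ψ : C →ₗ[k] A), homDeg 𝒞 𝒜 φ p → homDeg 𝒞 𝒜 ψ q →
        dτ (conv 𝒞 Δ φ ψ q) (p + q)
          = conv 𝒞 Δ (dτ φ p) ψ q + (Int.negOnePow p) • conv 𝒞 Δ φ (dτ ψ q) (q + 1)) ∧
      -- the twisted differential of `M ⊗_τ C` squares to zero ...
      (DMC.comp DMC = 0) ∧
      -- ... and the bimodule action satisfies the graded Leibniz rule for it, so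
      -- `M ⊗_τ C` is a dg bimodule over the twisted convolution algebra `Hom^τ(C,A)`
      (∀ (p q : ℤ) (φ ψ : C →ₗ[k] A), homDeg 𝒞 𝒜 φ p → homDeg 𝒞 𝒜 ψ q →
        DMC.comp (act φ ψ q)
          = act (dτ φ p) ψ q
            + (Int.negOnePow p) • ((act φ ψ q).comp DMC)
            + (Int.negOnePow p) • ((act φ (dτ ψ q) (q + 1)).comp sMC)) := by
  intro one act dMC sMC dτ DMC hone hact hdMC hsMC hdτ hDMC
  have hdτ' : ∀ (f : C →ₗ[k] A) (p : ℤ), dτ f p = dconv dC dA f p + conv 𝒞 Δ τ f p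
      + (- sg k p) • conv 𝒞 Δ f τ 1 := by
    intro f p
    rw [hdτ, unit_smul_sg (k := k)]; module
  have hassoc := conv_assoc 𝒞 hcoassoc hΔgr (A := A)
  have hleib := conv_leib 𝒞 𝒜 hΔgr hdCdeg hcoder hdAleib
  have hMC : dconv dC dA τ 1 = (-1 : k) • conv 𝒞 Δ τ τ 1 := by
    rw [eq_neg_of_add_eq_zero_left hτMC]; module
  refine ⟨?_, ?_, ?_, ?_⟩
  · intro p φ hφ
    simp only [hdτ', dconv_add, dconv_smul, conv_add_left, conv_add_right, conv_smul_left,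
      conv_smul_right, dconv_sq hdCsq hdAsq]
    have e1 := hleib 1 p τ φ hτdeg
    have e2 := hleib p 1 φ τ hφ
    rw [add_comm 1 p] at e1
    rw [e1, e2, hMC]
    simp only [conv_smul_left, conv_smul_right, hassoc, sg_add, sg_one, add_comm 1 p]
    rcases sg_cases (k := k) p with h | h <;> rw [h] <;> module
  · intro p q φ ψ hφ hψ
    simp only [hdτ', dconv_add, dconv_smul, conv_add_left, conv_add_right, conv_smul_left,
      conv_smul_right, unit_smul_sg (k := k)]
    rw [hleib p q φ ψ hφ]
    simp only [hassoc, sg_add, add_comm 1 q]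
    rcases sg_cases (k := k) p with h | h <;> rcases sg_cases (k := k) q with h' | h' <;>
      rw [h, h'] <;> module
  · have hL1 := Lop_one 𝒞 ℳ hcounitr hΔgr hεC0 hl1
    have hR1 := Rop_one 𝒞 ℳ hcounitl hΔgr hr1
    have hD : DMC = dMC + Lop 𝒞 ℳ Δ l τ - Rop 𝒞 Δ r τ 1 * sMC := by
      rw [hDMC, hact, hact_eq, hact_eq, hone, hL1, hR1, mul_one, one_mul]; rfl
    have a1 := d_d 𝒞 ℳ hdCsq hMsq hMdeg dMC hdMC
    have a2 := s_d 𝒞 ℳ hdCdeg hMdeg dMC sMC hdMC hsMC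
    have a3 := s_s 𝒞 ℳ sMC hsMC
    have a4 := d_Lop 𝒞 𝒜 ℳ hΔgr hdCdeg hcoder hldeg hMdeg hMleibl τ 1 hτdeg dMC hdMC
    have a5 := d_Rop 𝒞 𝒜 ℳ hΔgr hdCdeg hcoder hrdeg hMleibr τ 1 hτdeg dMC sMC hdMC hsMC
    have a6 := Lop_mul 𝒞 𝒜 ℳ hcoassoc hΔgr hlmul hldeg τ τ 1 hτdeg
    have a7 := Rop_mul 𝒞 ℳ hcoassoc hΔgr hrmul τ τ 1 1
    have a8 := Lop_Rop 𝒞 𝒜 ℳ hcoassoc hΔgr hlr hrdeg τ τ 1 hτdeg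
    have a9 := sMC_Lop 𝒞 𝒜 ℳ hΔgr hldeg τ 1 hτdeg sMC hsMC
    have a10 := sMC_Rop 𝒞 𝒜 ℳ hΔgr hrdeg τ 1 hτdeg sMC hsMC
    rw [hMC, Lop_smul, a6] at a4
    rw [hMC, Rop_smul, a7] at a5
    rw [sg_one] at a4 a9 a10
    change DMC * DMC = 0
    rw [hD]
    exact alg_sq (k := k) (R := Module.End k (M ⊗[k] C)) dMC sMC _ _ a1 a2 a3 a4 a5 a8 a9 a10
  · intro p q φ ψ hφ hψ
    have hL1 := Lop_one 𝒞 ℳ hcounitr hΔgr hεC0 hl1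
    have hR1 := Rop_one 𝒞 ℳ hcounitl hΔgr hr1
    have hD : DMC = dMC + Lop 𝒞 ℳ Δ l τ - Rop 𝒞 Δ r τ 1 * sMC := by
      rw [hDMC, hact, hact_eq, hact_eq, hone, hL1, hR1, mul_one, one_mul]; rfl
    have a4 := d_Lop 𝒞 𝒜 ℳ hΔgr hdCdeg hcoder hldeg hMdeg hMleibl φ p hφ dMC hdMC
    have a5 := d_Rop 𝒞 𝒜 ℳ hΔgr hdCdeg hcoder hrdeg hMleibr ψ q hψ dMC sMC hdMC hsMC
    have a6 := Lop_mul 𝒞 𝒜 ℳ hcoassoc hΔgr hlmul hldeg τ φ p hφ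
    have a6' := Lop_mul 𝒞 𝒜 ℳ hcoassoc hΔgr hlmul hldeg φ τ 1 hτdeg
    have a7 := Rop_mul 𝒞 ℳ hcoassoc hΔgr hrmul τ ψ 1 q
    have a7' := Rop_mul 𝒞 ℳ hcoassoc hΔgr hrmul ψ τ q 1
    have a8 := Lop_Rop 𝒞 𝒜 ℳ hcoassoc hΔgr hlr hrdeg φ τ 1 hτdeg
    have a8' := Lop_Rop 𝒞 𝒜 ℳ hcoassoc hΔgr hlr hrdeg τ ψ q hψ
    have a9 := sMC_Lop 𝒞 𝒜 ℳ hΔgr hldeg φ p hφ sMC hsMC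
    have a10 := sMC_Rop 𝒞 𝒜 ℳ hΔgr hrdeg ψ q hψ sMC hsMC
    rw [add_comm 1 q] at a7
    have key := alg_leib (k := k) (R := Module.End k (M ⊗[k] C)) dMC sMC _ _ _ _ _ _
      (sg k p) (sg k q) (sg_cases p) (sg_cases q) a4 a5 a8 a8' a9 a10
    rw [← a6, ← a6', ← a7, ← a7', ← Lop_smul, ← Rop_smul, ← Lop_add, ← Lop_add, ← Rop_add,
      ← Rop_add, ← hdτ', ← hdτ', ← hD] at key
    rw [unit_smul_sg (k := k), unit_smul_sg (k := k), hact, hact_eq, hact_eq, hact_eq]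
    exact key
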